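/- Let Γ = (S, Act, P) be a finite MDP that is clean with respect to a parity objective φ and with respect to target sets F_1, …, F_n ⊆ S, let s ∈ S be a state, and let p ∈ [0,1]^n. If there exists a strategy τ such that Γ, τ, s ⊨ ⋀_{i=1}^n Pr_{>p_i}(◇F_i), then there exists a finite-memory strategy σ such that Γ, σ, s ⊨ S(φ) ∧ ⋀_{i=1}^n Pr_{>p_i}(◇F_i). (Core content of Theorem 3 on one sure parity objective and n strict reachability thresholds.) -/

import Mathlib

open MeasureTheory ENNReal
open scoped Classical

/-! ### Markov chains on countable state spaces and their path measures -/

/-- The product σ-algebra on infinite paths over a (discrete) state space `T`. -/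
noncomputable def pathsMS (T : Type*) : MeasurableSpace (ℕ → T) :=
  @MeasurableSpace.pi ℕ (fun _ => T) (fun _ => ⊤)

/-- The cylinder set of all paths agreeing with `π` on the first `k+1` states. -/
def Cyl {T : Type*} (π : ℕ → T) (k : ℕ) : Set (ℕ → T) := {ω | ∀ i ≤ k, ω i = π i}

/-- `μ` is the path measure of the Markov chain with transition probabilities `P`
and initial state `s`: it is a probability measure assigning to each cylinder set the
product of the transition probabilities along its prefix. -/
def IsPathMeasure {T : Type*} (P : T → T → ℝ≥0∞) (s : T)
    (μ : @Measure (ℕ → T) (pathsMS T)) : Prop :=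
  μ Set.univ = 1 ∧
  ∀ (π : ℕ → T) (k : ℕ),
    μ (Cyl π k) = if π 0 = s then ∏ i ∈ Finset.range k, P (π i) (π (i + 1)) else 0

/-- The path measure `Pr^M_s` of a Markov chain (it exists and is unique by the
Ionescu–Tulcea/Carathéodory theorems; here it is taken by definite description). -/
noncomputable def pathMeasure {T : Type*} (P : T → T → ℝ≥0∞) (s : T) :
    @Measure (ℕ → T) (pathsMS T) :=
  if h : ∃ μ, IsPathMeasure P s μ then h.choose else 0

/-- `Paths^M_s`: infinite sequences starting at `s` all of whose steps have positive
transition probability. -/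
def PathsFrom {T : Type*} (P : T → T → ℝ≥0∞) (s : T) : Set (ℕ → T) :=
  {ω | ω 0 = s ∧ ∀ i, 0 < P (ω i) (ω (i + 1))}

/-! ### MDPs, strategies, objectives -/

/-- A finite Markov decision process: transition probabilities `P s a s'` such that
for each state-action pair the total mass is `0` or `1` (the action is *enabled* at `s`
in the latter case), and every state has an enabled action. -/
structure MDP (S Act : Type) [Fintype S] [Nonempty S] [Fintype Act] [Nonempty Act] where
  P : S → Act → S → ℝ≥0∞
  sum_mem : ∀ s a, (∑ s', P s a s') = 0 ∨ (∑ s', P s a s') = 1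
  exists_enabled : ∀ s, ∃ a, (∑ s', P s a s') = 1

variable {S Act : Type} [Fintype S] [Nonempty S] [Fintype Act] [Nonempty Act]

/-- A strategy: a machine with countable memory `Q`, initial mode `init`,
deterministic memory update `next`, and output distributions `out` supported on
enabled actions. -/
structure Strategy (M : MDP S Act) where
  Q : Type
  countable : Countable Q
  init : Q
  next : Q → S → Q
  out : Q → S → Act → ℝ≥0∞
  out_sum : ∀ q s, (∑ a, out q s a) = 1
  out_enabled : ∀ q s a, out q s a ≠ 0 → (∑ s', M.P s a s') = 1

/-- A strategy is finite-memory if its memory set is finite. -/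
def Strategy.FiniteMemory {M : MDP S Act} (σ : Strategy M) : Prop := Finite σ.Q

/-- The transition probabilities of the Markov chain `Γ^σ` induced by strategy `σ`
on the state space `S × Q`. -/
noncomputable def MDP.step (M : MDP S Act) (σ : Strategy M) : S × σ.Q → S × σ.Q → ℝ≥0∞ :=
  fun x y => if σ.next x.2 x.1 = y.2 then ∑ a, σ.out x.2 x.1 a * M.P x.1 a y.1 else 0

/-- Lifting an objective over `S` to paths over `S × Q` via the first component. -/
def liftObj {T Q : Type*} (Ω : Set (ℕ → T)) : Set (ℕ → T × Q) :=
  {ω | (fun i => (ω i).1) ∈ Ω}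

/-- `Pr^{Γ^σ}_{(s,q_ι)}(Ω)`: the probability of the (lifted) objective `Ω` in the
Markov chain induced by `σ` started at `(s, σ.init)`. -/
noncomputable def MDP.Pr (M : MDP S Act) (σ : Strategy M) (s : S) (Ω : Set (ℕ → S)) : ℝ≥0∞ :=
  pathMeasure (M.step σ) (s, σ.init) (liftObj Ω)

/-- `Γ, σ, s ⊨ S(Ω)`: every path of the induced Markov chain from `(s, σ.init)`
(surely) satisfies the lifted objective `Ω`. -/
def MDP.Sure (M : MDP S Act) (σ : Strategy M) (s : S) (Ω : Set (ℕ → S)) : Prop :=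
  PathsFrom (M.step σ) (s, σ.init) ⊆ liftObj Ω

/-- The reachability objective `◇F`. -/
def ReachObj {T : Type*} (F : Set T) : Set (ℕ → T) := {π | ∃ k, π k ∈ F}

/-- The set of states occurring infinitely often on a path. -/
def InfOft {T : Type*} (π : ℕ → T) : Set T := {s | ∀ i, ∃ j, i ≤ j ∧ π j = s}

/-- The parity objective for the priority function `φ`: the maximal priority occurring
infinitely often is even. -/
def ParityObj {T : Type*} (φ : T → ℕ) : Set (ℕ → T) := {π | Even (sSup (φ '' InfOft π))}

/-- A state is a sink if every enabled action loops with probability 1. -/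
def MDP.IsSink (M : MDP S Act) (s : S) : Prop :=
  ∀ a, (∑ s', M.P s a s') = 1 → M.P s a s = 1

/-- `Γ` is clean w.r.t. the parity objective `φ`: from every state some strategy
surely satisfies `φ`. -/
def MDP.CleanParity (M : MDP S Act) (φ : S → ℕ) : Prop :=
  ∀ s, ∃ σ : Strategy M, M.Sure σ s (ParityObj φ)

/-- `Γ` is clean w.r.t. the target sets `F 1, …, F n`: every target state is a sink and
from every state some strategy reaches `F = ⋃ i, F i` with probability 1. -/
def MDP.CleanTargets (M : MDP S Act) {n : ℕ} (F : Fin n → Set S) : Prop :=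
  (∀ s ∈ ⋃ i, F i, M.IsSink s) ∧
  ∀ s, ∃ σ : Strategy M, 1 ≤ M.Pr σ s (ReachObj (⋃ i, F i))


lemma infOft_shift {T : Type*} (π : ℕ → T) (k : ℕ) :
    InfOft (fun i => π (i + k)) = InfOft π := by
  ext v
  constructor
  · intro h i
    obtain ⟨j, hj, e⟩ := h i
    exact ⟨j + k, by omega, e⟩
  · intro h i
    obtain ⟨j, hj, e⟩ := h (i + k)
    refine ⟨j - k, by omega, ?_⟩
    have : j - k + k = j := by omega
    simp only [this, e]

lemma parity_shift {T : Type*} (φ : T → ℕ) (π : ℕ → T) (k : ℕ) :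
    (fun i => π (i + k)) ∈ ParityObj φ ↔ π ∈ ParityObj φ := by
  simp only [ParityObj, Set.mem_setOf_eq, infOft_shift]

lemma sSup_infOft {T : Type*} [Finite T] (φ : T → ℕ) (π : ℕ → T) (d : ℕ)
    (h1 : ∀ i, ∃ j, i ≤ j ∧ φ (π j) = d) (h2 : ∀ i, φ (π i) ≤ d) :
    sSup (φ '' InfOft π) = d := by
  have hv : ∃ v ∈ InfOft π, φ v = d := by
    by_contra hcon
    push Not at hcon
    have : ∀ v : T, ∃ i, φ v = d → ∀ j, i ≤ j → π j ≠ v := by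
      intro v
      by_cases hd : φ v = d
      · have h3 : v ∉ InfOft π := fun hh => hcon v hh hd
        simp only [InfOft, Set.mem_setOf_eq] at h3
        push Not at h3
        obtain ⟨i, hi⟩ := h3
        exact ⟨i, fun _ => hi⟩
      · exact ⟨0, fun h => absurd h hd⟩
    choose b hb using this
    obtain ⟨N, hN⟩ := (Set.finite_range b).bddAbove
    obtain ⟨j, hj, e⟩ := h1 N
    exact hb (π j) e j (le_trans (hN ⟨_, rfl⟩) hj) rfl
  obtain ⟨v, hv, hd⟩ := hv
  apply IsGreatest.csSup_eq
  refine ⟨⟨v, hv, hd⟩, ?_⟩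
  rintro _ ⟨w, hw, rfl⟩
  obtain ⟨j, _, rfl⟩ := hw 0
  exact h2 j

def attN {V A : Type} (E : V → A → Set V) (U T : Set V) : ℕ → Set V
  | 0 => T
  | n + 1 => attN E U T n ∪ {v | v ∈ U ∧ ∃ a, (E v a).Nonempty ∧ E v a ⊆ attN E U T n}

lemma attN_mono {V A : Type} (E : V → A → Set V) (U T : Set V) : Monotone (attN E U T) :=
  monotone_nat_of_le_succ fun n => by
    intro v hv; exact Or.inl hv

lemma attr_exists {V A : Type} [Finite V] [Nonempty A] (E : V → A → Set V) (U T : Set V)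
    (hTU : T ⊆ U) : ∃ (B : Set V) (f : V → A) (rk : V → ℕ), T ⊆ B ∧ B ⊆ U ∧
      (∀ v ∈ B, v ∉ T → (E v (f v)).Nonempty ∧ ∀ w ∈ E v (f v), w ∈ B ∧ rk w < rk v) ∧
      (∀ v ∈ U, v ∉ B → ∀ a, (E v a).Nonempty → ∃ w ∈ E v a, w ∉ B) := by
  set B : Set V := {v | ∃ n, v ∈ attN E U T n} with hB
  have hrk : ∀ v, ∃ n, v ∈ B → v ∈ attN E U T n ∧ ∀ m, v ∈ attN E U T m → n ≤ m := by
    intro v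
    by_cases hv : v ∈ B
    · exact ⟨Nat.find hv, fun _ => ⟨Nat.find_spec hv, fun m hm => Nat.find_min' hv hm⟩⟩
    · exact ⟨0, fun h => absurd h hv⟩
  choose rk hrk using hrk
  have hf : ∀ v, ∃ a, v ∈ B → v ∉ T →
      (E v a).Nonempty ∧ ∀ w ∈ E v a, w ∈ B ∧ rk w < rk v := by
    intro v
    by_cases hv : v ∈ B
    · obtain ⟨h1, h2⟩ := hrk v hv
      cases hn : rk v with
      | zero =>
        rw [hn] at h1
        exact ⟨Classical.arbitrary A, fun _ hT => absurd h1 hT⟩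
      | succ n =>
        rw [hn] at h1
        rcases h1 with h1 | ⟨_, a, ha, hs⟩
        · have := h2 n h1
          omega
        · refine ⟨a, fun _ _ => ⟨ha, fun w hw => ?_⟩⟩
          have hwB : w ∈ B := ⟨n, hs hw⟩
          exact ⟨hwB, Nat.lt_succ_of_le ((hrk w hwB).2 n (hs hw))⟩
    · exact ⟨Classical.arbitrary A, fun h => absurd h hv⟩
  choose f hf using hf
  refine ⟨B, f, rk, fun v hv => ⟨0, hv⟩, ?_, hf, ?_⟩
  · rintro v ⟨n, hn⟩
    induction n with
    | zero => exact hTU hn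
    | succ n ih =>
      rcases hn with hn | hn
      · exact ih hn
      · exact hn.1
  · intro v hvU hvB a hne
    by_contra hcon
    push Not at hcon
    obtain ⟨N, hN⟩ := (Set.finite_range rk).bddAbove
    apply hvB
    refine ⟨N + 1, Or.inr ⟨hvU, a, hne, fun w hw => ?_⟩⟩
    exact attN_mono E U T (hN ⟨w, rfl⟩) (hrk w (hcon w hw)).1

def canReach {X : Type} (R : X → X → Prop) (D G : Set X) : ℕ → Set X
  | 0 => G
  | n + 1 => {x | ∃ y ∈ D, R x y ∧ y ∈ canReach R D G n}

lemma inf_path {X : Type} (R : X → X → Prop) (D G : Set X)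
    (hne : D.Nonempty) (hsucc : ∀ x ∈ D, ∃ y ∈ D, R x y)
    (hreach : ∀ x ∈ D, ∃ n, x ∈ canReach R D G n) :
    ∃ ω : ℕ → X, (∀ i, ω i ∈ D ∧ R (ω i) (ω (i + 1))) ∧ ∀ i, ∃ j, i ≤ j ∧ ω j ∈ G := by
  have hrk : ∀ x, ∃ n, x ∈ D → x ∈ canReach R D G n ∧ ∀ m, x ∈ canReach R D G m → n ≤ m := by
    intro v
    by_cases hv : v ∈ D
    · have hv := hreach v hv
      exact ⟨Nat.find hv, fun _ => ⟨Nat.find_spec hv, fun m hm => Nat.find_min' hv hm⟩⟩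
    · exact ⟨0, fun h => absurd h hv⟩
  choose rk hrk using hrk
  have hg : ∀ x, ∃ y, x ∈ D → y ∈ D ∧ R x y ∧ (x ∉ G → rk y < rk x) := by
    intro x
    by_cases hx : x ∈ D
    · obtain ⟨h1, h2⟩ := hrk x hx
      cases hn : rk x with
      | zero =>
        rw [hn] at h1
        obtain ⟨y, hy, hR⟩ := hsucc x hx
        exact ⟨y, fun _ => ⟨hy, hR, fun h => absurd h1 h⟩⟩
      | succ n =>
        rw [hn] at h1
        obtain ⟨y, hy, hR, hyn⟩ := h1
        exact ⟨y, fun _ => ⟨hy, hR, fun _ => Nat.lt_succ_of_le ((hrk y hy).2 n hyn)⟩⟩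
    · exact ⟨x, fun h => absurd h hx⟩
  choose g hg using hg
  obtain ⟨x0, hx0⟩ := hne
  have hD : ∀ i, g^[i] x0 ∈ D := by
    intro i
    induction i with
    | zero => exact hx0
    | succ i ih => rw [Function.iterate_succ_apply']; exact (hg _ ih).1
  refine ⟨fun i => g^[i] x0, fun i => ⟨hD i, ?_⟩, ?_⟩
  · simp only [Function.iterate_succ_apply']
    exact (hg _ (hD i)).2.1
  · have : ∀ n i, rk (g^[i] x0) ≤ n → ∃ j, i ≤ j ∧ g^[j] x0 ∈ G := by
      intro n
      induction n with
      | zero =>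
        intro i hi
        refine ⟨i, le_rfl, ?_⟩
        by_contra hG
        have := (hg _ (hD i)).2.2 hG
        omega
      | succ n ih =>
        intro i hi
        by_cases hG : g^[i] x0 ∈ G
        · exact ⟨i, le_rfl, hG⟩
        · have := (hg _ (hD i)).2.2 hG
          obtain ⟨j, hj, hjG⟩ := ih (i + 1) (by rw [Function.iterate_succ_apply']; omega)
          exact ⟨j, by omega, hjG⟩
    exact fun i => this _ i le_rfl

theorem parity_game {V A : Type} [Finite V] [Nonempty A] (φ : V → ℕ) {X : Type}
    (R : X → X → Prop) (lab : X → V) :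
    ∀ (n : ℕ) (U : Set V) (E : V → A → Set V) (D : Set X), U.ncard < n →
      (∀ v a, E v a ⊆ U) → lab '' D = U →
      (∀ x ∈ D, ∃ a, (E (lab x) a).Nonempty ∧
        ∀ v ∈ E (lab x) a, ∃ y ∈ D, R x y ∧ lab y = v) →
      (∀ ω : ℕ → X, (∀ i, ω i ∈ D ∧ R (ω i) (ω (i + 1))) →
        (fun i => lab (ω i)) ∈ ParityObj φ) →
      ∃ f : V → A, (∀ v ∈ U, (E v (f v)).Nonempty) ∧
        ∀ π : ℕ → V, (∀ i, π i ∈ U ∧ π (i + 1) ∈ E (π i) (f (π i))) → π ∈ ParityObj φ := by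
  intro n
  induction n with
  | zero => intro U E D h; omega
  | succ n ih =>
    intro U E D hcard hEU hlab hD hpar
    have key : ∀ T : Set V, T ⊆ U → T.Nonempty → ∀ fT : V → A,
        (∀ v ∈ T, (E v (fT v)).Nonempty) →
        ∃ f : V → A, (∀ v ∈ T, f v = fT v) ∧ (∀ v ∈ U, (E v (f v)).Nonempty) ∧
          ∀ π : ℕ → V, (∀ i, π i ∈ U ∧ π (i + 1) ∈ E (π i) (f (π i))) →
            π ∈ ParityObj φ ∨ ∀ i, ∃ j, i ≤ j ∧ π j ∈ T := by
      intro T hTU hTne fT hfT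
      obtain ⟨B, fA, rk, hTB, hBU, hatt, htrap⟩ := attr_exists E U T hTU
      obtain ⟨fB, hfB1, hfB2⟩ := ih (U \ B) (fun v a => E v a ∩ (U \ B)) {x ∈ D | lab x ∈ U \ B}
        (by
          have : (U \ B).ncard < U.ncard := by
            apply Set.ncard_lt_ncard _ (Set.toFinite _)
            refine ⟨Set.diff_subset, fun h => ?_⟩
            obtain ⟨t, ht⟩ := hTne
            exact (h (hTU ht)).2 (hTB ht)
          omega)
        (fun v a => Set.inter_subset_right)
        (by
          ext v
          constructor
          · rintro ⟨x, hx, rfl⟩; exact hx.2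
          · intro hv
            have : v ∈ lab '' D := by rw [hlab]; exact hv.1
            obtain ⟨x, hx, rfl⟩ := this
            exact ⟨x, ⟨hx, hv⟩, rfl⟩)
        (by
          rintro x ⟨hx, hxU, hxB⟩
          obtain ⟨a, ha, hs⟩ := hD x hx
          refine ⟨a, ?_, ?_⟩
          · obtain ⟨w, hw, hwB⟩ := htrap _ hxU hxB a ha
            exact ⟨w, hw, hEU _ _ hw, hwB⟩
          · rintro v ⟨hv, hvB⟩
            obtain ⟨y, hy, hR, rfl⟩ := hs v hv
            exact ⟨y, ⟨hy, hvB⟩, hR, rfl⟩)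
        (fun ω hω => hpar ω fun i => ⟨(hω i).1.1, (hω i).2⟩)
      let f : V → A := fun v => if v ∈ T then fT v else if v ∈ B then fA v else fB v
      have f1 : ∀ v ∈ T, f v = fT v := fun v hv => if_pos hv
      have f2 : ∀ v ∈ B, v ∉ T → f v = fA v := fun v hv hT => by simp only [f, hv, hT, if_true, if_false]
      have f3 : ∀ v, v ∉ B → f v = fB v := fun v hv => by
        have hT : v ∉ T := fun h => hv (hTB h)
        simp only [f, hv, hT, if_false]
      refine ⟨f, f1, ?_, ?_⟩
      · intro v hv
        by_cases hT : v ∈ T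
        · rw [f1 v hT]; exact hfT v hT
        · by_cases hB : v ∈ B
          · rw [f2 v hB hT]; exact (hatt v hB hT).1
          · rw [f3 v hB]; exact (hfB1 v ⟨hv, hB⟩).mono Set.inter_subset_left
      · intro π hπ
        by_cases hev : ∃ k, ∀ j, k ≤ j → π j ∉ B
        · left
          obtain ⟨k, hk⟩ := hev
          rw [← parity_shift φ π k]
          apply hfB2
          intro i
          have h1 := hk (i + k) (by omega)
          have h2 := hk (i + 1 + k) (by omega)
          refine ⟨⟨(hπ _).1, h1⟩, ?_, (hπ _).1, h2⟩
          have := (hπ (i + k)).2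
          rw [f3 _ h1] at this
          convert this using 2
          omega
        · right
          push Not at hev
          have : ∀ m i, π i ∈ B → rk (π i) ≤ m → ∃ j, i ≤ j ∧ π j ∈ T := by
            intro m
            induction m with
            | zero =>
              intro i hiB hi
              refine ⟨i, le_rfl, ?_⟩
              by_contra hG
              have h1 := (hπ i).2
              rw [f2 _ hiB hG] at h1
              have := ((hatt _ hiB hG).2 _ h1).2
              omega
            | succ m ihm =>
              intro i hiB hi
              by_cases hG : π i ∈ T
              · exact ⟨i, le_rfl, hG⟩
              · have h1 := (hπ i).2
                rw [f2 _ hiB hG] at h1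
                have h2 := ((hatt _ hiB hG).2 _ h1)
                obtain ⟨j, hj, hjT⟩ := ihm (i + 1) h2.1 (by omega)
                exact ⟨j, by omega, hjT⟩
          intro i
          obtain ⟨j, hj, hjB⟩ := hev i
          obtain ⟨l, hl, hlT⟩ := this _ j hjB le_rfl
          exact ⟨l, by omega, hlT⟩
    rcases U.eq_empty_or_nonempty with hU | hU
    · exact ⟨fun _ => Classical.arbitrary A, fun v hv => by simp [hU] at hv,
        fun π hπ => by have := (hπ 0).1; simp [hU] at this⟩
    obtain ⟨v0, hv0, hmax⟩ := Set.exists_max_image U φ (Set.toFinite _) hU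
    have hDne : ∀ v ∈ U, ∃ a, (E v a).Nonempty := by
      intro v hv
      rw [← hlab] at hv
      obtain ⟨x, hx, rfl⟩ := hv
      obtain ⟨a, ha, _⟩ := hD x hx
      exact ⟨a, ha⟩
    rcases Nat.even_or_odd (φ v0) with hev | hodd
    · have : ∀ v, ∃ a, v ∈ U → (E v a).Nonempty := by
        intro v
        by_cases hv : v ∈ U
        · obtain ⟨a, ha⟩ := hDne v hv
          exact ⟨a, fun _ => ha⟩
        · exact ⟨Classical.arbitrary A, fun h => absurd h hv⟩
      choose fT hfT using this
      obtain ⟨f, -, h2, h3⟩ := key {v ∈ U | φ v = φ v0} (fun v hv => hv.1) ⟨v0, hv0, rfl⟩ fT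
        (fun v hv => hfT v hv.1)
      refine ⟨f, h2, fun π hπ => ?_⟩
      rcases h3 π hπ with h | h
      · exact h
      · have := sSup_infOft φ π (φ v0) (fun i => by
          obtain ⟨j, hj, hjT⟩ := h i
          exact ⟨j, hj, hjT.2⟩) (fun i => hmax _ (hπ i).1)
        simp only [ParityObj, Set.mem_setOf_eq, this, hev]
    · set G : Set X := {x | φ (lab x) = φ v0} with hG
      set DW : Set X := {x ∈ D | ∀ n, x ∉ canReach R D G n} with hDW
      have hDWne : DW.Nonempty := by
        by_contra hcon
        rw [Set.not_nonempty_iff_eq_empty] at hcon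
        have hDne' : D.Nonempty := by
          rw [← hlab] at hv0
          obtain ⟨x, hx, _⟩ := hv0
          exact ⟨x, hx⟩
        obtain ⟨ω, hω, hinf⟩ := inf_path R D G hDne'
          (fun x hx => by
            obtain ⟨a, ⟨v, hv⟩, hs⟩ := hD x hx
            obtain ⟨y, hy, hR, _⟩ := hs v hv
            exact ⟨y, hy, hR⟩)
          (fun x hx => by
            by_contra hh
            push Not at hh
            have : x ∈ DW := ⟨hx, hh⟩
            rw [hcon] at this
            exact this)
        have h1 := hpar ω hω
        have := sSup_infOft φ (fun i => lab (ω i)) (φ v0) hinf (fun i => hmax _ (by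
          rw [← hlab]; exact ⟨_, (hω i).1, rfl⟩))
        simp only [ParityObj, Set.mem_setOf_eq, this] at h1
        exact (Nat.not_even_iff_odd.2 hodd) h1
      set W : Set V := lab '' DW with hW
      have hWU : W ⊆ U := by
        rw [← hlab]; exact Set.image_mono fun x hx => hx.1
      obtain ⟨fW, hfW1, hfW2⟩ := ih W (fun v a => {w ∈ E v a | E v a ⊆ W}) DW
        (by
          have : W.ncard < U.ncard := by
            apply Set.ncard_lt_ncard _ (Set.toFinite _)
            refine ⟨hWU, fun h => ?_⟩
            obtain ⟨x, hx, hxe⟩ := h hv0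
            apply hx.2 0
            change φ (lab x) = φ v0
            rw [hxe]
          omega)
        (fun v a w hw => hw.2 hw.1) rfl
        (by
          rintro x ⟨hx, hxn⟩
          obtain ⟨a, ha, hs⟩ := hD x hx
          have hs' : ∀ v ∈ E (lab x) a, ∃ y ∈ DW, R x y ∧ lab y = v := by
            intro v hv
            obtain ⟨y, hy, hR, rfl⟩ := hs v hv
            exact ⟨y, ⟨hy, fun n hn => hxn (n + 1) ⟨y, hy, hR, hn⟩⟩, hR, rfl⟩
          have hsub : E (lab x) a ⊆ W := by
            intro v hv
            obtain ⟨y, hy, _, rfl⟩ := hs' v hv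
            exact ⟨y, hy, rfl⟩
          refine ⟨a, ?_, fun v hv => hs' v hv.1⟩
          obtain ⟨v, hv⟩ := ha
          exact ⟨v, hv, hsub⟩)
        (fun ω hω => hpar ω fun i => ⟨(hω i).1.1, (hω i).2⟩)
      obtain ⟨f, h1, h2, h3⟩ := key W hWU (hDWne.image _) fW
        (fun v hv => (hfW1 v hv).mono fun w hw => hw.1)
      refine ⟨f, h2, fun π hπ => ?_⟩
      rcases h3 π hπ with h | h
      · exact h
      · obtain ⟨k, -, hk⟩ := h 0
        have hclosed : ∀ v ∈ W, E v (f v) ⊆ W := by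
          intro v hv
          rw [h1 v hv]
          obtain ⟨w, hw⟩ := hfW1 v hv
          exact hw.2
        have hstay : ∀ i, π (i + k) ∈ W := by
          intro i
          induction i with
          | zero => simpa using hk
          | succ i ihi =>
            have := hclosed _ ihi (hπ (i + k)).2
            convert this using 2
            omega
        rw [← parity_shift φ π k]
        apply hfW2
        intro i
        refine ⟨hstay i, ?_⟩
        have h4 := (hπ (i + k)).2
        have h5 := hclosed _ (hstay i)
        rw [h1 _ (hstay i)] at h4 h5
        refine ⟨?_, h5⟩
        convert h4 using 2
        omega

open ProbabilityTheory in
lemma exists_pathMeasure {T : Type} [Countable T] (P : T → T → ℝ≥0∞)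
    (hP : ∀ x, ∑' y, P x y = 1) (s : T) : ∃ μ, IsPathMeasure P s μ := by
  let : MeasurableSpace T := ⊤
  have : DiscreteMeasurableSpace T := ⟨fun _ => trivial⟩
  let pm : T → PMF T := fun x => ⟨P x, by rw [← hP x]; exact ENNReal.summable.hasSum⟩
  let κ : (n : ℕ) → Kernel (Π _ : Finset.Iic n, T) T := fun n =>
    Kernel.ofFunOfCountable (fun x => (pm (x ⟨n, by simp⟩)).toMeasure)
  have : ∀ n, IsMarkovKernel (κ n) := fun n => ⟨fun x => by
    change IsProbabilityMeasure ((pm (x ⟨n, by simp⟩)).toMeasure)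
    infer_instance⟩
  let x0 : Π _ : Finset.Iic 0, T := fun _ => s
  let μ : Measure (ℕ → T) := Kernel.traj (X := fun _ => T) κ 0 x0
  have hμ : IsProbabilityMeasure μ := by
    change IsProbabilityMeasure (Kernel.traj (X := fun _ => T) κ 0 x0)
    infer_instance
  have hpt : ∀ (π : ℕ → T) (k : ℕ),
      Cyl π k = Preorder.frestrictLe (π := fun _ => T) k ⁻¹' {Preorder.frestrictLe (π := fun _ => T) k π} := by
    intro π k
    ext ω
    simp only [Cyl, Set.mem_preimage, Set.mem_singleton_iff]
    constructor
    · intro h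
      ext i
      exact h i.1 (Finset.mem_Iic.1 i.2)
    · intro h i hi
      exact congrFun h ⟨i, Finset.mem_Iic.2 hi⟩
  have hcyl : ∀ (π : ℕ → T) (k : ℕ),
      μ (Cyl π k) = if π 0 = s then ∏ i ∈ Finset.range k, P (π i) (π (i + 1)) else 0 := by
    intro π k
    induction k with
    | zero =>
      rw [hpt, ← Measure.map_apply (Preorder.measurable_frestrictLe 0) (measurableSet_singleton _)]
      change ((Kernel.traj (X := fun _ => T) κ 0 x0).map _) _ = _
      rw [Kernel.traj_map_frestrictLe_apply, Kernel.partialTraj_self, Kernel.id_apply,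
        Measure.dirac_apply' _ (measurableSet_singleton _)]
      by_cases h : π 0 = s
      · have : x0 = Preorder.frestrictLe (π := fun _ => T) 0 π := by
          ext i
          have : i.1 = 0 := by have := Finset.mem_Iic.1 i.2; omega
          simp only [x0, Preorder.frestrictLe_apply, this, h]
        simp [h, this]
      · have : x0 ≠ Preorder.frestrictLe (π := fun _ => T) 0 π := by
          intro hh
          exact h (congrFun hh ⟨0, by simp⟩).symm
        simp [h, this]
    | succ k ih =>
      have h1 : Cyl π (k + 1) = (fun x : ℕ → T => (Preorder.frestrictLe (π := fun _ => T) k x, x (k + 1))) ⁻¹'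
          ({Preorder.frestrictLe (π := fun _ => T) k π} ×ˢ {π (k + 1)}) := by
        ext ω
        have h2 := Set.ext_iff.1 (hpt π k) ω
        simp only [Set.mem_preimage, Set.mem_prod, Set.mem_singleton_iff] at h2 ⊢
        rw [← h2]
        constructor
        · intro h
          exact ⟨fun i hi => h i (by omega), h _ le_rfl⟩
        · rintro ⟨h, h'⟩ i hi
          rcases Nat.lt_or_ge k i with h3 | h3
          · have : i = k + 1 := by omega
            rw [this, h']
          · exact h i h3
      have h3 : μ (Cyl π k) = Kernel.partialTraj (X := fun _ => T) κ 0 k x0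
          {Preorder.frestrictLe (π := fun _ => T) k π} := by
        rw [hpt, ← Measure.map_apply (Preorder.measurable_frestrictLe k)
          (measurableSet_singleton _)]
        change ((Kernel.traj (X := fun _ => T) κ 0 x0).map _) _ = _
        rw [Kernel.traj_map_frestrictLe_apply]
      rw [h1, ← Measure.map_apply
        ((Preorder.measurable_frestrictLe k).prodMk (measurable_pi_apply _))
        ((measurableSet_singleton _).prod (measurableSet_singleton _))]
      change ((Kernel.traj (X := fun _ => T) κ 0 x0).map _) _ = _
      rw [← Kernel.partialTraj_compProd_eq_map_traj (X := fun _ => T) (κ := κ) (Nat.zero_le k),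
        Measure.compProd_apply_prod (measurableSet_singleton _) (measurableSet_singleton _),
        MeasureTheory.lintegral_singleton, ← h3, ih]
      have h4 : κ k (Preorder.frestrictLe (π := fun _ => T) k π) {π (k + 1)}
          = P (π k) (π (k + 1)) := by
        change (pm (π k)).toMeasure _ = _
        rw [PMF.toMeasure_apply_singleton _ _ (measurableSet_singleton _)]
        rfl
      rw [h4, Finset.prod_range_succ]
      split_ifs
      · rw [mul_comm]
      · simp
  exact ⟨μ, hμ.measure_univ, hcyl⟩

lemma step_tsum (M : MDP S Act) (σ : Strategy M) (x : S × σ.Q) : ∑' y, M.step σ x y = 1 := by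
  rw [ENNReal.tsum_prod (f := fun s' q' => M.step σ x (s', q'))]
  have h1 : ∀ s', ∑' q', M.step σ x (s', q') = ∑ a, σ.out x.2 x.1 a * M.P x.1 a s' := by
    intro s'
    simp only [MDP.step]
    rw [tsum_eq_single (σ.next x.2 x.1)]
    · simp
    · intro q hq
      rw [if_neg (fun h => hq h.symm)]
  simp only [h1]
  rw [tsum_fintype, Finset.sum_comm, ← σ.out_sum x.2 x.1]
  refine Finset.sum_congr rfl fun a _ => ?_
  rw [← Finset.mul_sum]
  by_cases h : σ.out x.2 x.1 a = 0
  · simp [h]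
  · rw [σ.out_enabled _ _ _ h, mul_one]

lemma path_ae {T : Type} [Countable T] (P : T → T → ℝ≥0∞) (s : T)
    (μ : @Measure (ℕ → T) (pathsMS T)) (hμ : IsPathMeasure P s μ) :
    μ {ω | ¬ (ω 0 = s ∧ ∀ i, P (ω i) (ω (i + 1)) ≠ 0)} = 0 := by
  let ext : (n : ℕ) → (Fin (n + 1) → T) → ℕ → T :=
    fun n u i => u ⟨min i n, by omega⟩
  have hsub : {ω : ℕ → T | ¬ (ω 0 = s ∧ ∀ i, P (ω i) (ω (i + 1)) ≠ 0)} ⊆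
      ⋃ (z : Σ n : ℕ, (Fin (n + 1) → T)), ⋃ (_ : μ (Cyl (ext z.1 z.2) z.1) = 0),
        Cyl (ext z.1 z.2) z.1 := by
    intro ω hω
    have aux : ∀ n, μ (Cyl ω n) = 0 → ω ∈ ⋃ (z : Σ n : ℕ, (Fin (n + 1) → T)),
        ⋃ (_ : μ (Cyl (ext z.1 z.2) z.1) = 0), Cyl (ext z.1 z.2) z.1 := by
      intro n hn
      have he : Cyl (ext n (fun i => ω i)) n = Cyl ω n := by
        ext ω'
        simp only [Cyl, ext]
        constructor
        · intro h i hi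
          have := h i hi
          rwa [min_eq_left hi] at this
        · intro h i hi
          have := h i hi
          simpa only [min_eq_left hi] using this
      refine Set.mem_iUnion₂.2 ⟨⟨n, fun i => ω i⟩, by simp only [he, hn], ?_⟩
      simp only [he]
      exact fun i _ => rfl
    by_cases h0 : ω 0 = s
    · have h1 : ∃ i, P (ω i) (ω (i + 1)) = 0 := by
        by_contra hcon
        push Not at hcon
        exact hω ⟨h0, hcon⟩
      obtain ⟨i, hi⟩ := h1
      apply aux (i + 1)
      rw [hμ.2, if_pos h0]
      exact Finset.prod_eq_zero (Finset.mem_range.2 (Nat.lt_succ_self i)) hi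
    · apply aux 0
      rw [hμ.2, if_neg h0]
  refine measure_mono_null hsub ?_
  rw [measure_iUnion_null_iff]
  intro z
  rw [measure_iUnion_null_iff]
  exact fun h => h

def modeSeq {M : MDP S Act} (σ : Strategy M) (u : ℕ → S) : ℕ → σ.Q
  | 0 => σ.init
  | n + 1 => σ.next (modeSeq σ u n) (u n)

lemma marginal (M : MDP S Act) (σ : Strategy M) (s : S)
    (μ : @Measure (ℕ → S × σ.Q) (pathsMS (S × σ.Q)))
    (hμ : IsPathMeasure (M.step σ) (s, σ.init) μ) (u : ℕ → S) (N : ℕ) :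
    μ {ω | ∀ i ≤ N, (ω i).1 = u i} =
      if u 0 = s then ∏ i ∈ Finset.range N,
        ∑ a, σ.out (modeSeq σ u i) (u i) a * M.P (u i) a (u (i + 1)) else 0 := by
  have := σ.countable
  have hnull := path_ae _ _ μ hμ
  have heq : μ {ω | ∀ i ≤ N, (ω i).1 = u i} =
      μ (Cyl (fun i => (u i, modeSeq σ u i)) N) := by
    apply le_antisymm
    · calc μ {ω | ∀ i ≤ N, (ω i).1 = u i}
          ≤ μ (Cyl (fun i => (u i, modeSeq σ u i)) N ∪
            {ω | ¬ (ω 0 = (s, σ.init) ∧ ∀ i, M.step σ (ω i) (ω (i + 1)) ≠ 0)}) := by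
            apply measure_mono
            intro ω hω
            by_cases hg : (ω 0 = (s, σ.init) ∧ ∀ i, M.step σ (ω i) (ω (i + 1)) ≠ 0)
            · left
              intro i hi
              refine Prod.ext (hω i hi) ?_
              induction i with
              | zero => simp [hg.1, modeSeq]
              | succ i ih =>
                have h1 := hg.2 i
                have h2 : σ.next (ω i).2 (ω i).1 = (ω (i + 1)).2 := by
                  by_contra h3
                  exact h1 (if_neg h3)
                have h4 := ih (by omega)
                have h5 := hω i (by omega)
                simp only at h4
                simp only [modeSeq, ← h2, h4, h5]
            · right; exact hg
        _ ≤ _ := measure_union_le _ _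
        _ = _ := by rw [hnull, add_zero]
    · apply measure_mono
      intro ω hω i hi
      rw [hω i hi]
  rw [heq, hμ.2]
  have h0 : ((u 0, modeSeq σ u 0) = (s, σ.init)) ↔ u 0 = s := by simp [modeSeq]
  simp only [h0]
  congr 1
  refine Finset.prod_congr rfl fun i _ => ?_
  simp [MDP.step, modeSeq]

lemma reach_le {T₁ T₂ : Type} (μ : @Measure (ℕ → S × T₁) (pathsMS (S × T₁)))
    (ν : @Measure (ℕ → S × T₂) (pathsMS (S × T₂))) (N : ℕ)
    (h : ∀ u : ℕ → S, μ {ω | ∀ i ≤ N, (ω i).1 = u i} ≤ ν {ω | ∀ i ≤ N, (ω i).1 = u i})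
    (F : Set S) : μ {ω | ∃ k ≤ N, (ω k).1 ∈ F} ≤ ν {ω | ∃ k ≤ N, (ω k).1 ∈ F} := by
  let ext : (Fin (N + 1) → S) → ℕ → S := fun u i => u ⟨min i N, by omega⟩
  let I : Finset (Fin (N + 1) → S) := Finset.univ.filter fun u => ∃ k, u k ∈ F
  have hmeas : ∀ u : ℕ → S, MeasurableSet[pathsMS (S × T₂)]
      {ω : ℕ → S × T₂ | ∀ i ≤ N, (ω i).1 = u i} := by
    intro u
    let _ : MeasurableSpace (S × T₂) := ⊤
    have he : {ω : ℕ → S × T₂ | ∀ i ≤ N, (ω i).1 = u i} =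
        ⋂ i, ⋂ (_ : i ≤ N), (fun ω : ℕ → S × T₂ => ω i) ⁻¹' {x | x.1 = u i} := by
      ext ω; simp
    rw [he]
    exact MeasurableSet.iInter fun i => MeasurableSet.iInter fun _ =>
      (measurable_pi_apply i) trivial
  have h1 : {ω : ℕ → S × T₁ | ∃ k ≤ N, (ω k).1 ∈ F} ⊆
      ⋃ u ∈ I, {ω | ∀ i ≤ N, (ω i).1 = ext u i} := by
    rintro ω ⟨k, hk, hF⟩
    refine Set.mem_iUnion₂.2 ⟨fun i => (ω i).1, ?_, ?_⟩
    · exact Finset.mem_filter.2 ⟨Finset.mem_univ _, ⟨k, by omega⟩, hF⟩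
    · intro i hi
      simp only [ext, min_eq_left hi]
  have h2 : ⋃ u ∈ I, {ω : ℕ → S × T₂ | ∀ i ≤ N, (ω i).1 = ext u i} ⊆
      {ω | ∃ k ≤ N, (ω k).1 ∈ F} := by
    intro ω hω
    obtain ⟨u, hu, hω⟩ := Set.mem_iUnion₂.1 hω
    obtain ⟨_, k, hk⟩ := Finset.mem_filter.1 hu
    have hkN : k.1 ≤ N := by have := k.2; omega
    refine ⟨k.1, hkN, ?_⟩
    rw [hω k.1 hkN]
    simpa only [ext, min_eq_left hkN] using hk
  calc μ {ω | ∃ k ≤ N, (ω k).1 ∈ F}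
      ≤ μ (⋃ u ∈ I, {ω | ∀ i ≤ N, (ω i).1 = ext u i}) := measure_mono h1
    _ ≤ ∑ u ∈ I, μ {ω | ∀ i ≤ N, (ω i).1 = ext u i} := measure_biUnion_finset_le _ _
    _ ≤ ∑ u ∈ I, ν {ω | ∀ i ≤ N, (ω i).1 = ext u i} := Finset.sum_le_sum fun u _ => h _
    _ = ν (⋃ u ∈ I, {ω | ∀ i ≤ N, (ω i).1 = ext u i}) := by
        rw [measure_biUnion_finset _ (fun u _ => hmeas _)]
        intro u _ v _ huv
        rw [Function.onFun, Set.disjoint_left]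
        intro ω hu hv
        apply huv
        funext k
        have hkN : k.1 ≤ N := by have := k.2; omega
        have h3 := (hu k.1 hkN).symm.trans (hv k.1 hkN)
        simpa only [ext, min_eq_left hkN] using h3
    _ ≤ _ := measure_mono h2

noncomputable def switchStrat (M : MDP S Act) (τ : Strategy M) (N : ℕ) (f : S → Act)
    (hf : ∀ v, ∑ s', M.P v (f v) s' = 1) : Strategy M where
  Q := {l : List S // l.length ≤ N}
  countable := inferInstance
  init := ⟨[], Nat.zero_le N⟩
  next := fun l v => if h : l.1.length < N then ⟨l.1 ++ [v], by simpa using h⟩ else l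
  out := fun l v a => if l.1.length < N then τ.out (l.1.foldl τ.next τ.init) v a
    else if a = f v then 1 else 0
  out_sum := by
    intro l v
    split_ifs
    · exact τ.out_sum _ _
    · simp
  out_enabled := by
    intro l v a h
    split_ifs at h with h1 h2
    · exact τ.out_enabled _ _ _ h
    · rw [h2]; exact hf v
    · exact absurd rfl h

lemma switch_next_lt (M : MDP S Act) (τ : Strategy M) (N : ℕ) (f : S → Act)
    (hf : ∀ v, ∑ s', M.P v (f v) s' = 1) (l : {l : List S // l.length ≤ N}) (v : S)
    (h : l.1.length < N) : ((switchStrat M τ N f hf).next l v).1 = l.1 ++ [v] :=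
  congrArg Subtype.val (dif_pos h)

lemma switch_next_ge (M : MDP S Act) (τ : Strategy M) (N : ℕ) (f : S → Act)
    (hf : ∀ v, ∑ s', M.P v (f v) s' = 1) (l : {l : List S // l.length ≤ N}) (v : S)
    (h : ¬ l.1.length < N) : (switchStrat M τ N f hf).next l v = l :=
  dif_neg h

lemma switch_mode (M : MDP S Act) (τ : Strategy M) (N : ℕ) (f : S → Act)
    (hf : ∀ v, ∑ s', M.P v (f v) s' = 1) (u : ℕ → S) (i : ℕ) (hi : i ≤ N) :
    (modeSeq (switchStrat M τ N f hf) u i).1.length = i ∧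
    (modeSeq (switchStrat M τ N f hf) u i).1.foldl τ.next τ.init = modeSeq τ u i := by
  induction i with
  | zero => exact ⟨rfl, rfl⟩
  | succ i ih =>
    obtain ⟨h1, h2⟩ := ih (by omega)
    have h3 : (modeSeq (switchStrat M τ N f hf) u (i + 1)).1 =
        (modeSeq (switchStrat M τ N f hf) u i).1 ++ [u i] := by
      have : (modeSeq (switchStrat M τ N f hf) u i).1.length < N := by omega
      exact switch_next_lt M τ N f hf _ _ this
    rw [h3]
    constructor
    · simp [h1]
    · rw [List.foldl_append, h2]; rfl

lemma switch_sure (M : MDP S Act) (τ : Strategy M) (N : ℕ) (f : S → Act)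
    (hf : ∀ v, ∑ s', M.P v (f v) s' = 1) (φ : S → ℕ)
    (hwin : ∀ π : ℕ → S, (∀ i, M.P (π i) (f (π i)) (π (i + 1)) ≠ 0) → π ∈ ParityObj φ) (s : S) :
    M.Sure (switchStrat M τ N f hf) s (ParityObj φ) := by
  rintro ω ⟨h0, hstep⟩
  have hnext : ∀ i, (switchStrat M τ N f hf).next (ω i).2 (ω i).1 = (ω (i + 1)).2 := by
    intro i
    by_contra h
    exact (hstep i).ne' (if_neg h)
  have hlen : ∀ i, (ω i).2.1.length = min i N := by
    intro i
    induction i with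
    | zero => rw [h0]; simp [switchStrat]
    | succ i ih =>
      rw [← hnext i]
      by_cases h : (ω i).2.1.length < N
      · rw [switch_next_lt M τ N f hf _ _ h, List.length_append, List.length_singleton]; omega
      · rw [switch_next_ge M τ N f hf _ _ h]; omega
  change (fun i => (ω i).1) ∈ ParityObj φ
  rw [← parity_shift φ _ N]
  apply hwin
  intro i hz
  have h1 := (hstep (i + N)).ne'
  apply h1
  rw [MDP.step, if_pos (hnext _)]
  apply Finset.sum_eq_zero
  intro a _
  have h2 : ¬ (ω (i + N)).2.1.length < N := by rw [hlen]; omega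
  change (if (ω (i + N)).2.1.length < N then _ else if a = f (ω (i + N)).1 then 1 else 0) * _ = _
  rw [if_neg h2]
  have h3 : i + N + 1 = i + 1 + N := by omega
  split_ifs with ha
  · rw [ha, h3, hz, mul_zero]
  · rw [zero_mul]

lemma positional_parity (M : MDP S Act) (φ : S → ℕ) (hc : M.CleanParity φ) :
    ∃ f : S → Act, (∀ v, ∑ s', M.P v (f v) s' = 1) ∧
      ∀ π : ℕ → S, (∀ i, M.P (π i) (f (π i)) (π (i + 1)) ≠ 0) → π ∈ ParityObj φ := by
  choose σ hσ using hc
  let X : Type := Σ s : S, S × (σ s).Q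
  let R : X → X → Prop := fun x y => ∃ (s : S) (x' y' : S × (σ s).Q),
    x = ⟨s, x'⟩ ∧ y = ⟨s, y'⟩ ∧ 0 < M.step (σ s) x' y'
  have hR : ∀ s x' (y : X), R ⟨s, x'⟩ y → ∃ y', y = ⟨s, y'⟩ ∧ 0 < M.step (σ s) x' y' := by
    rintro s x' y ⟨s2, a, b, h1, h2, h3⟩
    obtain rfl : s = s2 := congrArg Sigma.fst h1
    obtain rfl : x' = a := eq_of_heq (Sigma.mk.inj h1).2
    exact ⟨b, h2, h3⟩
  let lab : X → S := fun x => x.2.1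
  let D : Set X := {x | PathsFrom (M.step (σ x.1)) x.2 ⊆ liftObj (ParityObj φ)}
  obtain ⟨f, hf1, hf2⟩ := parity_game (A := Act) φ R lab _ Set.univ
    (fun v a => {w | M.P v a w ≠ 0}) D (Nat.lt_succ_self _) (fun _ _ => Set.subset_univ _)
    (by
      refine Set.eq_univ_of_forall fun v => ?_
      exact ⟨⟨v, v, (σ v).init⟩, hσ v, rfl⟩)
    (by
      rintro ⟨s, v, q⟩ hx
      have hsum := (σ s).out_sum q v
      have : ∃ a, (σ s).out q v a ≠ 0 := by
        by_contra hcon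
        push Not at hcon
        simp [hcon] at hsum
      obtain ⟨a, ha⟩ := this
      refine ⟨a, ?_, ?_⟩
      · have hen := (σ s).out_enabled q v a ha
        by_contra hcon
        have : ∀ w, M.P v a w = 0 := by
          intro w
          by_contra hw
          exact hcon ⟨w, hw⟩
        simp [this] at hen
      · intro w hw
        have hpos : 0 < M.step (σ s) (v, q) (w, (σ s).next q v) := by
          rw [MDP.step, if_pos rfl]
          refine lt_of_lt_of_le ?_ (Finset.single_le_sum
            (f := fun a => (σ s).out q v a * M.P v a w) (fun _ _ => zero_le) (Finset.mem_univ a))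
          exact pos_iff_ne_zero.2 (mul_ne_zero ha hw)
        refine ⟨⟨s, w, (σ s).next q v⟩, ?_, ⟨s, _, _, rfl, rfl, hpos⟩, rfl⟩
        rintro ω ⟨h0, hω⟩
        let ω' : ℕ → S × (σ s).Q := fun i => Nat.casesOn i (v, q) ω
        have h1 : ω' ∈ liftObj (ParityObj φ) := by
          apply hx
          refine ⟨rfl, fun i => ?_⟩
          cases i with
          | zero =>
            change 0 < M.step (σ s) (v, q) (ω 0)
            rw [h0]; exact hpos
          | succ i => exact hω i
        exact (parity_shift φ (fun i => (ω' i).1) 1).2 h1)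
    (by
      intro ω hω
      have h0 : ∀ i, ∃ y, ω i = ⟨(ω 0).1, y⟩ := by
        intro i
        induction i with
        | zero => exact ⟨(ω 0).2, rfl⟩
        | succ i ih =>
          obtain ⟨y, hy⟩ := ih
          have h1 := (hω i).2
          rw [hy] at h1
          obtain ⟨y', hy', _⟩ := hR _ _ _ h1
          exact ⟨y', hy'⟩
      choose y hy using h0
      have h2 : y ∈ PathsFrom (M.step (σ (ω 0).1)) (ω 0).2 := by
        refine ⟨?_, fun i => ?_⟩
        · have := hy 0
          have h3 : (⟨(ω 0).1, (ω 0).2⟩ : X) = ⟨(ω 0).1, y 0⟩ := this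
          exact (eq_of_heq (Sigma.mk.inj h3).2).symm
        · have h1 := (hω i).2
          rw [hy i] at h1
          obtain ⟨y', hy', hpos⟩ := hR _ _ _ h1
          rw [hy (i + 1)] at hy'
          have := eq_of_heq (Sigma.mk.inj hy').2
          rw [this]; exact hpos
      have h4 := (hω 0).1 h2
      have h5 : (fun i => lab (ω i)) = fun i => (y i).1 := by
        funext i
        change (ω i).2.1 = _
        rw [hy i]
      rw [h5]
      exact h4)
  refine ⟨f, fun v => ?_, fun π hπ => hf2 π fun i => ⟨Set.mem_univ _, hπ i⟩⟩
  rcases M.sum_mem v (f v) with h | h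
  · obtain ⟨w, hw⟩ := hf1 v (Set.mem_univ v)
    exact absurd ((Finset.sum_eq_zero_iff.1 h) w (Finset.mem_univ w)) hw
  · exact h


/-- Theorem 3, core content: in a clean MDP, if some strategy meets `n`
strict sink-reachability thresholds, then some *finite-memory* strategy surely satisfies the
parity objective while still meeting all strict thresholds. -/
theorem sure_parity_and_strict_reachability_thresholds
    {S Act : Type} [Fintype S] [Nonempty S] [Fintype Act] [Nonempty Act] {n : ℕ}
    (M : MDP S Act) (φ : S → ℕ) (F : Fin n → Set S)
    (hclean_par : M.CleanParity φ) (hclean_tgt : M.CleanTargets F)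
    (s : S) (p : Fin n → ℝ) (hp : ∀ i, p i ∈ Set.Icc (0 : ℝ) 1)
    (h : ∃ τ : Strategy M, ∀ i, ENNReal.ofReal (p i) < M.Pr τ s (ReachObj (F i))) :
    ∃ σ : Strategy M, σ.FiniteMemory ∧ M.Sure σ s (ParityObj φ) ∧
      ∀ i, ENNReal.ofReal (p i) < M.Pr σ s (ReachObj (F i)) := by

  obtain ⟨τ, hτ⟩ := h
  obtain ⟨f, hf, hwin⟩ := positional_parity M φ hclean_par
  rcases isEmpty_or_nonempty (Fin n) with hn | hn
  · refine ⟨switchStrat M τ 0 f hf, ?_, switch_sure M τ 0 f hf φ hwin s, fun i => hn.elim i⟩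
    exact (List.finite_length_le S 0).to_subtype
  have hex : ∃ μ, IsPathMeasure (M.step τ) (s, τ.init) μ := by
    by_contra hcon
    have := hτ (Classical.arbitrary _)
    rw [MDP.Pr, pathMeasure, dif_neg hcon] at this
    simp at this
  set μ := pathMeasure (M.step τ) (s, τ.init) with hμdef
  have hμ : IsPathMeasure (M.step τ) (s, τ.init) μ := by
    rw [hμdef, pathMeasure, dif_pos hex]
    exact hex.choose_spec
  have hN : ∀ i, ∃ N, ∀ N', N ≤ N' →
      ENNReal.ofReal (p i) < μ {ω | ∃ k ≤ N', (ω k).1 ∈ F i} := by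
    intro i
    have h1 := hτ i
    have h2 : (liftObj (ReachObj (F i)) : Set (ℕ → S × τ.Q)) =
        ⋃ N, {ω | ∃ k ≤ N, (ω k).1 ∈ F i} := by
      ext ω
      simp only [Set.mem_iUnion]
      constructor
      · rintro ⟨k, hk⟩; exact ⟨k, k, le_rfl, hk⟩
      · rintro ⟨_, k, _, hk⟩; exact ⟨k, hk⟩
    have hmono : Monotone fun N => {ω : ℕ → S × τ.Q | ∃ k ≤ N, (ω k).1 ∈ F i} := by
      rintro a b hab ω ⟨k, hk, hF⟩
      exact ⟨k, hk.trans hab, hF⟩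
    rw [MDP.Pr, h2, hmono.measure_iUnion, lt_iSup_iff] at h1
    obtain ⟨N, hN⟩ := h1
    exact ⟨N, fun N' hN' => lt_of_lt_of_le hN (measure_mono (hmono hN'))⟩
  choose Ni hNi using hN
  obtain ⟨N, hN⟩ := (Set.finite_range Ni).bddAbove
  refine ⟨switchStrat M τ N f hf, (List.finite_length_le S N).to_subtype,
    switch_sure M τ N f hf φ hwin s, fun i => ?_⟩
  set σ := switchStrat M τ N f hf with hσ
  have hcount := σ.countable
  have hex' := exists_pathMeasure (M.step σ) (step_tsum M σ) (s, σ.init)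
  have hν : IsPathMeasure (M.step σ) (s, σ.init) (pathMeasure (M.step σ) (s, σ.init)) := by
    rw [pathMeasure, dif_pos hex']
    exact hex'.choose_spec
  refine lt_of_lt_of_le (hNi i N (hN ⟨i, rfl⟩)) ?_
  refine le_trans (reach_le μ (pathMeasure (M.step σ) (s, σ.init)) N ?_ (F i)) ?_
  · intro u
    rw [marginal M τ s μ hμ u N, marginal M σ s _ hν u N]
    apply le_of_eq
    congr 1
    refine Finset.prod_congr rfl fun j hj => ?_
    have hj := Finset.mem_range.1 hj
    obtain ⟨h1, h2⟩ := switch_mode M τ N f hf u j hj.le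
    refine Finset.sum_congr rfl fun a _ => ?_
    congr 1
    symm
    change (if (modeSeq (switchStrat M τ N f hf) u j).1.length < N then _ else _) = _
    rw [if_pos (by omega), h2]
  · apply measure_mono
    rintro ω ⟨k, _, hk⟩
    exact ⟨k, hk⟩
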